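/- arXiv:2103.02653 — 4 statements merged into one kernel-verified Lean document; each statement's English description precedes it below -/
import Mathlib

section
/- First averaging identity for a leftward transport equation with zero boundary value at x = 1 (equations (replacement-p1) and (theta-k) of the paper). Let λ > 0, τ_k = 1/λ, τ > 0, and T ≥ τ_k + τ. Let v : [0,T] × [0,1] → ℝ be continuously differentiable with ∂_t v(t,x) = −λ ∂_x v(t,x) for all (t,x) ∈ [0,T] × [0,1], and v(t,1) = 0 for all t ∈ [0,T]. Then for every t ∈ [τ, T]: ∫₀¹ v(t − τ s, s) ds = (1/(τ_k + τ)) ∫_τ^t v(s, 0) ds. -/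
open Set

/-- First averaging identity for a leftward transport equation with zero boundary value at
`x = 1` (equations (replacement-p1) and (theta-k) of the paper). -/
theorem stmt9 (lam τk τ T : ℝ) (hlam : 0 < lam) (hτk : τk = 1 / lam)
    (hτ : 0 < τ) (hT : τk + τ ≤ T)
    (v vt vx : ℝ → ℝ → ℝ)
    (hv : ContinuousOn (fun p : ℝ × ℝ => v p.1 p.2) (Icc 0 T ×ˢ Icc 0 1))
    (hvtc : ContinuousOn (fun p : ℝ × ℝ => vt p.1 p.2) (Icc 0 T ×ˢ Icc 0 1))
    (hvxc : ContinuousOn (fun p : ℝ × ℝ => vx p.1 p.2) (Icc 0 T ×ˢ Icc 0 1))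
    (hvt : ∀ t ∈ Icc (0:ℝ) T, ∀ x ∈ Icc (0:ℝ) 1,
      HasDerivWithinAt (fun s => v s x) (vt t x) (Icc 0 T) t)
    (hvx : ∀ t ∈ Icc (0:ℝ) T, ∀ x ∈ Icc (0:ℝ) 1,
      HasDerivWithinAt (fun y => v t y) (vx t x) (Icc 0 1) x)
    (hpde : ∀ t ∈ Icc (0:ℝ) T, ∀ x ∈ Icc (0:ℝ) 1, vt t x = -lam * vx t x)
    (hbdry : ∀ t ∈ Icc (0:ℝ) T, v t 1 = 0) :
    ∀ t ∈ Icc τ T,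
      (∫ s in (0:ℝ)..1, v (t - τ * s) s) = (1 / (τk + τ)) * ∫ s in τ..t, v s 0 := by
  have hτk0 : 0 < τk := by rw [hτk]; positivity
  have hlk : lam * τk = 1 := by rw [hτk]; field_simp
  -- constancy along characteristics
  have hchar : ∀ t x d : ℝ, 0 ≤ d → 0 ≤ t → t + d ≤ T → 0 ≤ x → x + lam * d ≤ 1 →
      v (t + d) (x + lam * d) = v t x := by
    intro t x d hd ht htd hx hxd
    rcases hd.eq_or_lt with rfl | hd
    · simp
    obtain ⟨c, hc, h⟩ := exists_hasDerivAt_eq_slope (fun s => v (t + s) (x + lam * s))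
      (fun _ => 0) hd (by
        refine hv.comp (f := fun s : ℝ => ((t + s, x + lam * s) : ℝ × ℝ)) (by fun_prop) ?_
        intro s hs
        have h1 := mul_le_mul_of_nonneg_left hs.2 hlam.le
        have h2 := mul_nonneg hlam.le hs.1
        simp only [mem_Icc] at hs
        simp only [mem_prod, mem_Icc]
        refine ⟨⟨?_, ?_⟩, ?_, ?_⟩ <;> linarith) (by
        intro s hs
        have h1 := mul_lt_mul_of_pos_left hs.2 hlam
        have h2 := mul_pos hlam hs.1
        simp only [mem_Ioo] at hs
        have hmem : ((t + s, x + lam * s) : ℝ × ℝ) ∈ Ioo 0 T ×ˢ Ioo (0:ℝ) 1 := by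
          simp only [mem_prod, mem_Ioo]
          refine ⟨⟨?_, ?_⟩, ?_, ?_⟩ <;> linarith
        have hn : Ioo 0 T ×ˢ Ioo (0:ℝ) 1 ∈ nhds ((t + s, x + lam * s) : ℝ × ℝ) :=
          (isOpen_Ioo.prod isOpen_Ioo).mem_nhds hmem
        have hn' : Icc 0 T ×ˢ Icc (0:ℝ) 1 ∈ nhds ((t + s, x + lam * s) : ℝ × ℝ) :=
          Filter.mem_of_superset hn (prod_mono Ioo_subset_Icc_self Ioo_subset_Icc_self)
        have key := hasStrictFDerivAt_uncurry_coprod (𝕜 := ℝ) (u := (t + s, x + lam * s))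
          (f := v) (f₁ := fun a b => ContinuousLinearMap.toSpanSingleton ℝ (vt a b))
          (f₂ := fun a b => ContinuousLinearMap.toSpanSingleton ℝ (vx a b))
          (by
            filter_upwards [hn] with p hp
            exact ((hvt p.1 (Ioo_subset_Icc_self hp.1) p.2
              (Ioo_subset_Icc_self hp.2)).hasDerivAt (Icc_mem_nhds hp.1.1 hp.1.2)).hasFDerivAt)
          (by
            filter_upwards [hn] with p hp
            exact ((hvx p.1 (Ioo_subset_Icc_self hp.1) p.2
              (Ioo_subset_Icc_self hp.2)).hasDerivAt (Icc_mem_nhds hp.2.1 hp.2.2)).hasFDerivAt)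
          ((ContinuousLinearMap.toSpanSingletonCLE (𝕜 := ℝ) (E := ℝ)).continuous.continuousAt.comp
            (hvtc.continuousAt hn'))
          ((ContinuousLinearMap.toSpanSingletonCLE (𝕜 := ℝ) (E := ℝ)).continuous.continuousAt.comp
            (hvxc.continuousAt hn'))
        have hline : HasDerivAt (fun s : ℝ => ((t + s, x + lam * s) : ℝ × ℝ)) (1, lam) s := by
          refine HasDerivAt.prodMk ((hasDerivAt_id s).const_add t) ?_
          simpa using ((hasDerivAt_id s).const_mul lam).const_add x
        have := key.hasFDerivAt.comp_hasDerivAt s hline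
        refine this.congr_deriv ?_
        have hp := hpde (t + s) (Ioo_subset_Icc_self hmem.1) (x + lam * s)
          (Ioo_subset_Icc_self hmem.2)
        simp [Function.HasUncurry.uncurry, hp])
    have hd' : d - 0 ≠ 0 := by simpa using hd.ne'
    rw [eq_div_iff hd'] at h
    simp at h
    linarith
  set g : ℝ → ℝ := fun r => v (max 0 (min r T)) 0 with hg
  have hT0 : 0 ≤ T := by linarith
  have hgc : Continuous g := by
    refine hv.comp_continuous (f := fun r : ℝ => ((max 0 (min r T), 0) : ℝ × ℝ)) (by fun_prop) ?_
    intro r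
    simp only [mem_prod, mem_Icc]
    exact ⟨⟨le_max_left _ _, max_le hT0 (min_le_right _ _)⟩, le_rfl, zero_le_one⟩
  have hg0 : ∀ r, r ≤ T - τk → g r = 0 := by
    intro r hr
    have h1 : max 0 (min r T) + τk ≤ T := by
      have : max 0 (min r T) ≤ T - τk := max_le (by linarith) ((min_le_left _ _).trans hr)
      linarith
    have h0 : 0 ≤ max 0 (min r T) := le_max_left _ _
    have := hchar (max 0 (min r T)) 0 τk hτk0.le h0 h1 le_rfl (by linarith)
    rw [hlk, zero_add, hbdry _ ⟨by linarith, h1⟩] at this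
    exact this.symm
  have hgr : ∀ r, 0 ≤ r → r ≤ T → g r = v r 0 := by
    intro r h0 h1
    simp only [hg, min_eq_left h1, max_eq_right h0]
  have hvg : ∀ t x, 0 ≤ t → t ≤ T → 0 ≤ x → x ≤ 1 → v t x = g (t - τk * x) := by
    intro t x ht0 htT hx0 hx1
    have hp : 0 ≤ τk * x := by positivity
    have hp' : lam * (τk * x) = x := by rw [← mul_assoc, hlk, one_mul]
    have hq : 0 ≤ τk * (1 - x) := mul_nonneg hτk0.le (by linarith)
    have hq' : lam * (τk * (1 - x)) = 1 - x := by rw [← mul_assoc, hlk, one_mul]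
    by_cases h : t - τk * x ≤ T - τk
    · rw [hg0 _ h]
      have h1 : t + τk * (1 - x) ≤ T := by linarith
      have := hchar t x (τk * (1 - x)) hq ht0 h1 hx0 (by linarith)
      rw [hq', add_sub_cancel, hbdry _ ⟨by linarith, h1⟩] at this
      exact this.symm
    · push Not at h
      rw [hgr _ (by linarith) (by linarith)]
      have := hchar (t - τk * x) 0 (τk * x) hp (by linarith) (by linarith) le_rfl (by linarith)
      rw [hp', zero_add, sub_add_cancel] at this
      exact this
  rintro t ⟨ht1, ht2⟩
  have hL : (∫ s in (0:ℝ)..1, v (t - τ * s) s) = ∫ s in (0:ℝ)..1, g (t - (τk + τ) * s) := by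
    refine intervalIntegral.integral_congr fun s hs => ?_
    rw [uIcc_of_le zero_le_one] at hs
    have h1 := mul_le_mul_of_nonneg_left hs.2 hτ.le
    have h2 := mul_nonneg hτ.le hs.1
    show v (t - τ * s) s = g (t - (τk + τ) * s)
    rw [hvg (t - τ * s) s (by linarith) (by linarith) hs.1 hs.2]
    congr 1
    ring
  have hR : (∫ s in τ..t, v s 0) = ∫ s in τ..t, g s := by
    refine intervalIntegral.integral_congr fun s hs => ?_
    rw [uIcc_of_le ht1] at hs
    exact (hgr s (by linarith [hs.1]) (by linarith [hs.2])).symm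
  have hZ : (∫ s in (t - (τk + τ))..τ, g s) = 0 := by
    rw [intervalIntegral.integral_congr (g := fun _ => (0:ℝ)), intervalIntegral.integral_zero]
    intro s hs
    refine hg0 s (hs.2.trans (max_le ?_ ?_)) <;> linarith
  rw [hL, hR, intervalIntegral.integral_comp_sub_mul g (by positivity : τk + τ ≠ 0),
    mul_one, mul_zero, sub_zero, ← intervalIntegral.integral_add_adjacent_intervals
      (hgc.intervalIntegrable _ _) (hgc.intervalIntegrable τ t), hZ, zero_add, smul_eq_mul, one_div]
end

section
/- Second averaging identity for a rightward transport equation with zero boundary value at x = 1 and zero final datum (equations (replacement-p2) and (theta-k+1) of the paper). Let λ > 0, τ_{k+1} = 1/λ, let τ satisfy 0 < τ < τ_{k+1}, and let T ≥ τ_{k+1}. Let v : [0,T] × [0,1] → ℝ be continuously differentiable with ∂_t v(t,x) = λ ∂_x v(t,x) for all (t,x) ∈ [0,T] × [0,1], v(t,1) = 0 for all t ∈ [0,T], and v(T,x) = 0 for all x ∈ [0,1]. Then for every t ∈ [τ, τ_{k+1}]: ∫₀¹ v(t − τ s, s) ds = (1/(τ_{k+1} − τ)) ∫_t^{τ_{k+1}}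 v(s, 0) ds. -/
open Set

lemma char_const (lam τk1 T : ℝ) (hlam : 0 < lam) (hτk1 : τk1 = 1 / lam)
    (v vt vx : ℝ → ℝ → ℝ)
    (hv : ContinuousOn (fun p : ℝ × ℝ => v p.1 p.2) (Icc 0 T ×ˢ Icc 0 1))
    (hvtc : ContinuousOn (fun p : ℝ × ℝ => vt p.1 p.2) (Icc 0 T ×ˢ Icc 0 1))
    (hvxc : ContinuousOn (fun p : ℝ × ℝ => vx p.1 p.2) (Icc 0 T ×ˢ Icc 0 1))
    (hvt : ∀ t ∈ Icc (0:ℝ) T, ∀ x ∈ Icc (0:ℝ) 1,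
      HasDerivWithinAt (fun s => v s x) (vt t x) (Icc 0 T) t)
    (hvx : ∀ t ∈ Icc (0:ℝ) T, ∀ x ∈ Icc (0:ℝ) 1,
      HasDerivWithinAt (fun y => v t y) (vx t x) (Icc 0 1) x)
    (hpde : ∀ t ∈ Icc (0:ℝ) T, ∀ x ∈ Icc (0:ℝ) 1, vt t x = lam * vx t x)
    (c p q : ℝ) (hpq : p ≤ q) (hp : 0 ≤ p) (hq : q ≤ 1)
    (hcp : c - τk1 * p ≤ T) (hcq : 0 ≤ c - τk1 * q) :
    v (c - τk1 * p) p = v (c - τk1 * q) q := by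
  have hk : 0 < τk1 := by rw [hτk1]; positivity
  rcases hpq.eq_or_lt with h | hlt
  · rw [h]
  have hcont : ContinuousOn (fun y => v (c - τk1 * y) y) (Icc p q) := by
    refine hv.comp (f := fun y : ℝ => ((c - τk1 * y, y) : ℝ × ℝ)) (by fun_prop) ?_
    intro y hy
    have h1 := mul_le_mul_of_nonneg_left hy.1 hk.le
    have h2 := mul_le_mul_of_nonneg_left hy.2 hk.le
    exact ⟨⟨by dsimp only; linarith, by dsimp only; linarith⟩,
      ⟨hp.trans hy.1, hy.2.trans hq⟩⟩
  have hder : ∀ y ∈ Ioo p q, HasDerivAt (fun y => v (c - τk1 * y) y) ((fun _ => (0:ℝ)) y) y := by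
    intro y hy
    have h1 := mul_lt_mul_of_pos_left hy.1 hk
    have h2 := mul_lt_mul_of_pos_left hy.2 hk
    have ht : c - τk1 * y ∈ Ioo 0 T := ⟨by linarith, by linarith⟩
    have hy' : y ∈ Ioo (0:ℝ) 1 := ⟨by linarith [hy.1], by linarith [hy.2]⟩
    have hnh : Ioo (0:ℝ) T ×ˢ Ioo (0:ℝ) 1 ∈ nhds ((c - τk1 * y, y) : ℝ × ℝ) :=
      (isOpen_Ioo.prod isOpen_Ioo).mem_nhds ⟨ht, hy'⟩
    have hnh' : Icc (0:ℝ) T ×ˢ Icc (0:ℝ) 1 ∈ nhds ((c - τk1 * y, y) : ℝ × ℝ) :=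
      Filter.mem_of_superset hnh (prod_mono Ioo_subset_Icc_self Ioo_subset_Icc_self)
    have hF := hasStrictFDerivAt_uncurry_coprod (𝕜 := ℝ) (u := ((c - τk1 * y, y) : ℝ × ℝ))
      (f := v) (f₁ := fun a b => ContinuousLinearMap.toSpanSingleton ℝ (vt a b))
      (f₂ := fun a b => ContinuousLinearMap.toSpanSingleton ℝ (vx a b))
      (by
        filter_upwards [hnh] with w hw
        exact ((hvt w.1 (Ioo_subset_Icc_self hw.1) w.2 (Ioo_subset_Icc_self hw.2)).hasDerivAt
          (Icc_mem_nhds hw.1.1 hw.1.2)).hasFDerivAt)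
      (by
        filter_upwards [hnh] with w hw
        exact ((hvx w.1 (Ioo_subset_Icc_self hw.1) w.2 (Ioo_subset_Icc_self hw.2)).hasDerivAt
          (Icc_mem_nhds hw.2.1 hw.2.2)).hasFDerivAt)
      ((ContinuousLinearMap.toSpanSingletonCLE (𝕜 := ℝ) (E := ℝ)).continuous.continuousAt.comp
        (hvtc.continuousAt hnh'))
      ((ContinuousLinearMap.toSpanSingletonCLE (𝕜 := ℝ) (E := ℝ)).continuous.continuousAt.comp
        (hvxc.continuousAt hnh'))
    have hcurve : HasDerivAt (fun y : ℝ => ((c - τk1 * y, y) : ℝ × ℝ)) (-τk1, 1) y := by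
      refine HasDerivAt.prodMk ?_ (hasDerivAt_id y)
      simpa using ((hasDerivAt_id y).const_mul τk1).const_sub c
    have := HasFDerivAt.comp_hasDerivAt (f := fun y : ℝ => ((c - τk1 * y, y) : ℝ × ℝ)) y hF.hasFDerivAt hcurve
    refine this.congr_deriv ?_
    have e := hpde _ (Ioo_subset_Icc_self ht) _ (Ioo_subset_Icc_self hy')
    have e2 : τk1 * lam = 1 := by rw [hτk1]; field_simp
    simp [Function.HasUncurry.uncurry, e]
    linear_combination (-vx (c - τk1 * y) y) * e2
  obtain ⟨z, -, hz⟩ := exists_hasDerivAt_eq_slope _ _ hlt hcont hder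
  have : q - p ≠ 0 := by linarith
  field_simp at hz
  linarith

/-- Second averaging identity for a rightward transport equation with zero boundary value at
`x = 1` and zero final datum (equations (replacement-p2) and (theta-k+1) of the paper). -/
theorem stmt10 (lam τk1 τ T : ℝ) (hlam : 0 < lam) (hτk1 : τk1 = 1 / lam)
    (hτ : 0 < τ) (hττ : τ < τk1) (hT : τk1 ≤ T)
    (v vt vx : ℝ → ℝ → ℝ)
    (hv : ContinuousOn (fun p : ℝ × ℝ => v p.1 p.2) (Icc 0 T ×ˢ Icc 0 1))
    (hvtc : ContinuousOn (fun p : ℝ × ℝ => vt p.1 p.2) (Icc 0 T ×ˢ Icc 0 1))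
    (hvxc : ContinuousOn (fun p : ℝ × ℝ => vx p.1 p.2) (Icc 0 T ×ˢ Icc 0 1))
    (hvt : ∀ t ∈ Icc (0:ℝ) T, ∀ x ∈ Icc (0:ℝ) 1,
      HasDerivWithinAt (fun s => v s x) (vt t x) (Icc 0 T) t)
    (hvx : ∀ t ∈ Icc (0:ℝ) T, ∀ x ∈ Icc (0:ℝ) 1,
      HasDerivWithinAt (fun y => v t y) (vx t x) (Icc 0 1) x)
    (hpde : ∀ t ∈ Icc (0:ℝ) T, ∀ x ∈ Icc (0:ℝ) 1, vt t x = lam * vx t x)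
    (hbdry : ∀ t ∈ Icc (0:ℝ) T, v t 1 = 0)
    (hfinal : ∀ x ∈ Icc (0:ℝ) 1, v T x = 0) :
    ∀ t ∈ Icc τ τk1,
      (∫ s in (0:ℝ)..1, v (t - τ * s) s) = (1 / (τk1 - τ)) * ∫ s in t..τk1, v s 0 := by
  have hk : 0 < τk1 := hτ.trans hττ
  have key := char_const lam τk1 T hlam hτk1 v vt vx hv hvtc hvxc hvt hvx hpde
  intro t ht
  have hd : 0 < τk1 - τ := by linarith
  set F : ℝ → ℝ := fun r => if r ≤ τk1 then v r 0 else 0 with hF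
  have h1 : (∫ s in (0:ℝ)..1, v (t - τ * s) s) = ∫ s in (0:ℝ)..1, F (t + (τk1 - τ) * s) := by
    apply intervalIntegral.integral_congr
    intro s hs
    rw [uIcc_of_le zero_le_one] at hs
    have hs1 : τ * s ≤ τ := by nlinarith [hs.2]
    have hs0 : 0 ≤ τ * s := mul_nonneg hτ.le hs.1
    have hs2 : 0 ≤ τk1 * s := mul_nonneg hk.le hs.1
    simp only [hF]
    split_ifs with h
    · have := key (t + (τk1 - τ) * s) 0 s hs.1 le_rfl hs.2 (by linarith) (by linarith [ht.1])
      rw [mul_zero, sub_zero] at this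
      rw [this]
      congr 1
      ring
    · push Not at h
      have := key (t + (τk1 - τ) * s) s 1 hs.2 hs.1 le_rfl (by linarith [ht.2]) (by linarith)
      rw [hbdry _ ⟨by linarith, by nlinarith [ht.2, hs.2]⟩] at this
      rw [← this]
      congr 1
      ring
  have c0 : ContinuousOn (fun s => v s 0) (Icc t τk1) := by
    refine hv.comp (f := fun y : ℝ => ((y, 0) : ℝ × ℝ)) (by fun_prop) ?_
    intro y hy
    exact ⟨⟨by dsimp only; linarith [hy.1, ht.1], by dsimp only; linarith [hy.2]⟩, by simp⟩
  have e1 : EqOn (fun s => v s 0) F (uIcc t τk1) := by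
    intro s hs
    rw [uIcc_of_le ht.2] at hs
    simp [hF, hs.2]
  have hle : τk1 ≤ t + (τk1 - τ) := by linarith [ht.1]
  have e2 : EqOn (fun _ => (0:ℝ)) F (uIoc τk1 (t + (τk1 - τ))) := by
    intro s hs
    rw [uIoc_of_le hle] at hs
    simp [hF, hs.1]
  have i1 : IntervalIntegrable F MeasureTheory.volume t τk1 :=
    (c0.intervalIntegrable_of_Icc ht.2).congr (e1.mono uIoc_subset_uIcc)
  have i2 : IntervalIntegrable F MeasureTheory.volume τk1 (t + (τk1 - τ)) :=
    intervalIntegrable_const.congr e2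
  have z2 : ∫ s in τk1..(t + (τk1 - τ)), F s = 0 := by
    rw [← intervalIntegral.integral_congr_ae (Filter.Eventually.of_forall fun x hx => e2 hx)]
    simp
  rw [h1, intervalIntegral.integral_comp_add_mul F hd.ne', mul_zero, add_zero, mul_one,
    ← intervalIntegral.integral_add_adjacent_intervals i1 i2, z2, add_zero,
    ← intervalIntegral.integral_congr e1, smul_eq_mul, one_div]
end

section
/- Conservation of the duality pairing when the direct solution has zero control (Lemma 3.3 of the paper, stated for classical solutions). Let k, m ≥ 1, n = k+m, T > 0. Let λ₁,…,λ_{k+m} : [0,1] → (0,∞) be C¹ functions; set Σ(x) = diag(−λ₁(x),…,−λ_k(x), λ_{k+1}(x),…,λ_{k+m}(x)), Σ₋(x) = diag(−λ₁(x),…,−λ_k(x)), Σ₊(x) = diag(λ_{k+1}(x),…,λ_{k+m}(x)), and let Σ′ be the derivative of Σ. Let B ∈ ℝ^{k×m}, let C : [0,T] × [0,1] → ℝ^{n×n} be continuous, and let u, v : [0,T] × [0,1] → ℝⁿ be continuously differentiable with: ∂_t u = Σ(x)∂_x u + C(t,x)u, u₋(t,0) = B u₊(t,0) for all t, and u₊(t,1)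 = 0 for all t; ∂_t v = Σ(x)∂_x v + (Σ′(x) − C(t,x)ᵀ)v, v₋(t,1) = 0 for all t, and Σ₊(0) v₊(t,0) = −Bᵀ Σ₋(0) v₋(t,0) for all t. Then ∫₀¹ ⟨u(T,x), v(T,x)⟩ dx = ∫₀¹ ⟨u(0,x), v(0,x)⟩ dx. -/
open Set

theorem ftc_aux {a b : ℝ} (hab : a ≤ b) {f f' : ℝ → ℝ}
    (h : ∀ x ∈ Icc a b, HasDerivWithinAt f (f' x) (Icc a b) x)
    (hc : ContinuousOn f' (Icc a b)) : ∫ x in a..b, f' x = f b - f a := by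
  refine intervalIntegral.integral_eq_sub_of_hasDerivAt_of_le hab
    (fun x hx => (h x hx).continuousWithinAt) (fun x hx => ?_) ?_
  · exact (h x (Ioo_subset_Icc_self hx)).hasDerivAt (Icc_mem_nhds hx.1 hx.2)
  · exact ContinuousOn.intervalIntegrable (by rwa [uIcc_of_le hab])

/-- Conservation of the duality pairing when the direct solution has zero control (Lemma 3.3 of
the paper, for classical solutions). Here `n = k + m`, `Σ(x) = diag(−λ₁(x),…,−λ_k(x),
λ_{k+1}(x),…,λ_{k+m}(x))`, the direct solution `u` satisfies `u₋(t,0) = B u₊(t,0)` and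
`u₊(t,1) = 0`, and the adjoint solution `v` satisfies `v₋(t,1) = 0` and
`Σ₊(0) v₊(t,0) = −Bᵀ Σ₋(0) v₋(t,0)`. -/
theorem stmt12 (k m : ℕ) (hk : 1 ≤ k) (hm : 1 ≤ m) (T : ℝ) (hT : 0 < T)
    (lam lam' : Fin (k + m) → ℝ → ℝ)
    (hpos : ∀ i, ∀ x ∈ Icc (0:ℝ) 1, 0 < lam i x)
    (hlam : ∀ i, ∀ x ∈ Icc (0:ℝ) 1, HasDerivWithinAt (lam i) (lam' i x) (Icc 0 1) x)
    (hlamc : ∀ i, ContinuousOn (lam' i) (Icc 0 1))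
    (B : Matrix (Fin k) (Fin m) ℝ)
    (C : ℝ → ℝ → Fin (k + m) → Fin (k + m) → ℝ)
    (hC : ContinuousOn (fun p : ℝ × ℝ => C p.1 p.2) (Icc 0 T ×ˢ Icc 0 1))
    (u ut ux v vt vx : ℝ → ℝ → Fin (k + m) → ℝ)
    (hu : ContinuousOn (fun p : ℝ × ℝ => u p.1 p.2) (Icc 0 T ×ˢ Icc 0 1))
    (hutc : ContinuousOn (fun p : ℝ × ℝ => ut p.1 p.2) (Icc 0 T ×ˢ Icc 0 1))
    (huxc : ContinuousOn (fun p : ℝ × ℝ => ux p.1 p.2) (Icc 0 T ×ˢ Icc 0 1))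
    (hv : ContinuousOn (fun p : ℝ × ℝ => v p.1 p.2) (Icc 0 T ×ˢ Icc 0 1))
    (hvtc : ContinuousOn (fun p : ℝ × ℝ => vt p.1 p.2) (Icc 0 T ×ˢ Icc 0 1))
    (hvxc : ContinuousOn (fun p : ℝ × ℝ => vx p.1 p.2) (Icc 0 T ×ˢ Icc 0 1))
    (hut : ∀ t ∈ Icc (0:ℝ) T, ∀ x ∈ Icc (0:ℝ) 1, ∀ i,
      HasDerivWithinAt (fun s => u s x i) (ut t x i) (Icc 0 T) t)
    (hux : ∀ t ∈ Icc (0:ℝ) T, ∀ x ∈ Icc (0:ℝ) 1, ∀ i,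
      HasDerivWithinAt (fun y => u t y i) (ux t x i) (Icc 0 1) x)
    (hvt : ∀ t ∈ Icc (0:ℝ) T, ∀ x ∈ Icc (0:ℝ) 1, ∀ i,
      HasDerivWithinAt (fun s => v s x i) (vt t x i) (Icc 0 T) t)
    (hvx : ∀ t ∈ Icc (0:ℝ) T, ∀ x ∈ Icc (0:ℝ) 1, ∀ i,
      HasDerivWithinAt (fun y => v t y i) (vx t x i) (Icc 0 1) x)
    -- direct system: ∂_t u = Σ(x) ∂_x u + C(t,x) u
    (hupde : ∀ t ∈ Icc (0:ℝ) T, ∀ x ∈ Icc (0:ℝ) 1, ∀ i : Fin (k + m),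
      ut t x i = (if (i : ℕ) < k then -lam i x else lam i x) * ux t x i +
        ∑ j, C t x i j * u t x j)
    -- u₋(t,0) = B u₊(t,0)
    (hu0 : ∀ t ∈ Icc (0:ℝ) T, ∀ j : Fin k,
      u t 0 (Fin.castAdd m j) = ∑ i : Fin m, B j i * u t 0 (Fin.natAdd k i))
    -- u₊(t,1) = 0
    (hu1 : ∀ t ∈ Icc (0:ℝ) T, ∀ i : Fin m, u t 1 (Fin.natAdd k i) = 0)
    -- adjoint system: ∂_t v = Σ(x) ∂_x v + (Σ′(x) − C(t,x)ᵀ) v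
    (hvpde : ∀ t ∈ Icc (0:ℝ) T, ∀ x ∈ Icc (0:ℝ) 1, ∀ i : Fin (k + m),
      vt t x i = (if (i : ℕ) < k then -lam i x else lam i x) * vx t x i +
        (if (i : ℕ) < k then -lam' i x else lam' i x) * v t x i -
        ∑ j, C t x j i * v t x j)
    -- v₋(t,1) = 0
    (hv1 : ∀ t ∈ Icc (0:ℝ) T, ∀ j : Fin k, v t 1 (Fin.castAdd m j) = 0)
    -- Σ₊(0) v₊(t,0) = −Bᵀ Σ₋(0) v₋(t,0)
    (hv0 : ∀ t ∈ Icc (0:ℝ) T, ∀ i : Fin m,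
      lam (Fin.natAdd k i) 0 * v t 0 (Fin.natAdd k i) =
        -∑ j : Fin k, B j i * (-lam (Fin.castAdd m j) 0 * v t 0 (Fin.castAdd m j))) :
    (∫ x in (0:ℝ)..1, ∑ i, u T x i * v T x i) =
      ∫ x in (0:ℝ)..1, ∑ i, u 0 x i * v 0 x i := by
  have c1 : ∀ {f : ℝ → ℝ → Fin (k + m) → ℝ},
      ContinuousOn (fun p : ℝ × ℝ => f p.1 p.2) (Icc 0 T ×ˢ Icc 0 1) → ∀ i,
      ContinuousOn (fun p : ℝ × ℝ => f p.1 p.2 i) (Icc 0 T ×ˢ Icc 0 1) :=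
    fun hf i => continuousOn_pi.1 hf i
  set g : ℝ → ℝ → ℝ := fun t x => ∑ i, (ut t x i * v t x i + u t x i * vt t x i) with hg
  have hgc : ContinuousOn (fun p : ℝ × ℝ => g p.1 p.2) (Icc 0 T ×ˢ Icc 0 1) := by
    refine continuousOn_finsetSum _ fun i _ => ?_
    exact ((c1 hutc i).mul (c1 hv i)).add ((c1 hu i).mul (c1 hvtc i))
  have hgt : ∀ x ∈ Icc (0:ℝ) 1, ContinuousOn (fun t => g t x) (Icc 0 T) := fun x hx =>
    hgc.comp (f := fun t : ℝ => (t, x)) (by fun_prop) (fun t ht => ⟨ht, hx⟩)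
  have hgx : ∀ t ∈ Icc (0:ℝ) T, ContinuousOn (fun x => g t x) (Icc 0 1) := fun t ht =>
    hgc.comp (f := fun x : ℝ => (t, x)) (by fun_prop) (fun x hx => ⟨ht, hx⟩)
  have hFc : ∀ t ∈ Icc (0:ℝ) T, ContinuousOn (fun x => ∑ i, u t x i * v t x i) (Icc 0 1) := by
    intro t ht
    refine continuousOn_finsetSum _ fun i _ => ?_
    exact ContinuousOn.mul (fun x hx => (hux t ht x hx i).continuousWithinAt)
      (fun x hx => (hvx t ht x hx i).continuousWithinAt)
  have hint : ∀ t ∈ Icc (0:ℝ) T, IntervalIntegrable (fun x => ∑ i, u t x i * v t x i)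
      MeasureTheory.volume 0 1 := fun t ht =>
    ContinuousOn.intervalIntegrable (by rw [uIcc_of_le zero_le_one]; exact hFc t ht)
  have h0 : (0:ℝ) ∈ Icc (0:ℝ) T := ⟨le_rfl, hT.le⟩
  have h1 : T ∈ Icc (0:ℝ) T := ⟨hT.le, le_rfl⟩
  -- integral in time
  have htime : ∀ x ∈ Icc (0:ℝ) 1, ∫ t in (0:ℝ)..T, g t x =
      (∑ i, u T x i * v T x i) - ∑ i, u 0 x i * v 0 x i := by
    intro x hx
    refine ftc_aux (f := fun t => ∑ i, u t x i * v t x i) hT.le (fun t ht => ?_) (hgt x hx)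
    exact HasDerivWithinAt.fun_sum fun i _ => (hut t ht x hx i).mul (hvt t ht x hx i)
  -- integral in space
  have hspace : ∀ t ∈ Icc (0:ℝ) T, ∫ x in (0:ℝ)..1, g t x = 0 := by
    intro t ht
    have key := ftc_aux (f := fun x => ∑ i : Fin (k + m),
      (if (i : ℕ) < k then -lam i x else lam i x) * (u t x i * v t x i)) (f' := g t)
      zero_le_one (fun x hx => ?_) (hgx t ht)
    · rw [key]
      simp only [Fin.sum_univ_add, Fin.val_castAdd, Fin.is_lt, if_true, Fin.val_natAdd,
        not_lt.2 (Nat.le_add_right k _), if_false, hu1 t ht, hv1 t ht, mul_zero, zero_mul,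
        Finset.sum_const_zero, add_zero, zero_sub, neg_eq_zero]
      have e2 : ∀ i : Fin m, lam (Fin.natAdd k i) 0 *
          (u t 0 (Fin.natAdd k i) * v t 0 (Fin.natAdd k i)) =
          ∑ j : Fin k, u t 0 (Fin.natAdd k i) *
            (B j i * (lam (Fin.castAdd m j) 0 * v t 0 (Fin.castAdd m j))) := by
        intro i
        rw [← Finset.mul_sum, mul_left_comm, hv0 t ht i, ← Finset.sum_neg_distrib]
        congr 1
        exact Finset.sum_congr rfl fun j _ => by ring
      rw [Finset.sum_congr rfl fun i _ => e2 i, Finset.sum_comm, ← Finset.sum_add_distrib]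
      refine Finset.sum_eq_zero fun j _ => ?_
      rw [hu0 t ht j, Finset.sum_mul, Finset.mul_sum, ← Finset.sum_add_distrib]
      exact Finset.sum_eq_zero fun i _ => by ring
    · have hs : ∀ i : Fin (k + m), HasDerivWithinAt
          (fun x => if (i : ℕ) < k then -lam i x else lam i x)
          (if (i : ℕ) < k then -lam' i x else lam' i x) (Icc 0 1) x := by
        intro i
        split_ifs
        · exact (hlam i x hx).fun_neg
        · exact hlam i x hx
      have hd := HasDerivWithinAt.fun_sum (u := Finset.univ) fun i _ =>
        (hs i).fun_mul ((hux t ht x hx i).fun_mul (hvx t ht x hx i))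
      refine hd.congr_deriv ?_
      have hcomm : ∑ i, (∑ j, C t x i j * u t x j) * v t x i =
          ∑ i, u t x i * ∑ j, C t x j i * v t x j := by
        simp only [Finset.sum_mul, Finset.mul_sum]
        rw [Finset.sum_comm]
        exact Finset.sum_congr rfl fun i _ => Finset.sum_congr rfl fun j _ => by ring
      rw [← sub_eq_zero] at hcomm ⊢
      rw [← neg_eq_zero, ← hcomm, ← Finset.sum_sub_distrib, ← Finset.sum_sub_distrib,
        ← Finset.sum_neg_distrib]
      refine Finset.sum_congr rfl fun i _ => ?_
      rw [hupde t ht x hx i, hvpde t ht x hx i]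
      ring
  rw [← sub_eq_zero, ← intervalIntegral.integral_sub (hint T h1) (hint 0 h0)]
  have e1 : ∫ x in (0:ℝ)..1, ((∑ i, u T x i * v T x i) - ∑ i, u 0 x i * v 0 x i) =
      ∫ x in (0:ℝ)..1, ∫ t in (0:ℝ)..T, g t x := by
    refine intervalIntegral.integral_congr fun x hx => ?_
    rw [uIcc_of_le zero_le_one] at hx
    exact (htime x hx).symm
  rw [e1, ← MeasureTheory.intervalIntegral_intervalIntegral_swap]
  · rw [intervalIntegral.integral_congr (g := fun _ => (0:ℝ))]
    · simp
    · intro t ht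
      rw [uIcc_of_le hT.le] at ht
      exact hspace t ht
  · rw [uIoc_of_le hT.le, uIoc_of_le zero_le_one]
    exact (hgc.integrableOn_compact (isCompact_Icc.prod isCompact_Icc)).mono_set
      (prod_mono Ioc_subset_Icc_self Ioc_subset_Icc_self)
end

section
/- Conservation of the duality pairing when the adjoint solution has zero observation (Lemma 3.4 of the paper, stated for classical solutions). Let k, m ≥ 1, n = k+m, T > 0. Let λ₁,…,λ_{k+m} : [0,1] → (0,∞) be C¹ functions; set Σ(x) = diag(−λ₁(x),…,−λ_k(x), λ_{k+1}(x),…,λ_{k+m}(x)), Σ₋(x) = diag(−λ₁(x),…,−λ_k(x)), Σ₊(x) = diag(λ_{k+1}(x),…,λ_{k+m}(x)), and let Σ′ be the derivative of Σ. Let B ∈ ℝ^{k×m}, let C : [0,T] × [0,1] → ℝ^{n×n} be continuous, and let u, v : [0,T] × [0,1] → ℝⁿ be continuously differentiable with: ∂_t u = Σ(x)∂_x u + C(t,x)u and u₋(t,0) = B u₊(t,0) for all t (the boundary values u₊(t,1) are arbitrary); ∂_t v = Σ(x)∂_x v + (Σ′(x) − C(t,x)ᵀ)v, v₋(t,1)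 = 0 and v₊(t,1) = 0 for all t, and Σ₊(0) v₊(t,0) = −Bᵀ Σ₋(0) v₋(t,0) for all t. Then ∫₀¹ ⟨u(T,x), v(T,x)⟩ dx = ∫₀¹ ⟨u(0,x), v(0,x)⟩ dx. -/
open Set

theorem aux_ftc (a b : ℝ) (hab : a ≤ b) (f f' : ℝ → ℝ)
    (hd : ∀ x ∈ Icc a b, HasDerivWithinAt f (f' x) (Icc a b) x)
    (hc : ContinuousOn f' (Icc a b)) : ∫ x in a..b, f' x = f b - f a := by
  refine intervalIntegral.integral_eq_sub_of_hasDerivAt_of_le hab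
    (fun x hx => (hd x hx).continuousWithinAt)
    (fun x hx => (hd x (Ioo_subset_Icc_self hx)).hasDerivAt (Icc_mem_nhds hx.1 hx.2)) ?_
  exact ContinuousOn.intervalIntegrable (by rwa [uIcc_of_le hab])

theorem aux_swap (T : ℝ) (hT : 0 < T) (F D G : ℝ → ℝ → ℝ)
    (hF0 : ∀ t ∈ Icc (0:ℝ) T, ContinuousOn (F t) (Icc 0 1))
    (hD : ContinuousOn (fun p : ℝ × ℝ => D p.1 p.2) (Icc 0 T ×ˢ Icc 0 1))
    (hFt : ∀ t ∈ Icc (0:ℝ) T, ∀ x ∈ Icc (0:ℝ) 1,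
      HasDerivWithinAt (fun s => F s x) (D t x) (Icc 0 T) t)
    (hGx : ∀ t ∈ Icc (0:ℝ) T, ∀ x ∈ Icc (0:ℝ) 1,
      HasDerivWithinAt (fun y => G t y) (D t x) (Icc 0 1) x)
    (hG : ∀ t ∈ Icc (0:ℝ) T, G t 1 = G t 0) :
    ∫ x in (0:ℝ)..1, F T x = ∫ x in (0:ℝ)..1, F 0 x := by
  have h01 : (0:ℝ) ≤ 1 := zero_le_one
  have i1 : ∀ t ∈ Icc (0:ℝ) T, IntervalIntegrable (F t) MeasureTheory.volume 0 1 := fun t ht =>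
    ContinuousOn.intervalIntegrable (by rw [uIcc_of_le h01]; exact hF0 t ht)
  rw [← sub_eq_zero, ← intervalIntegral.integral_sub (i1 T ⟨hT.le, le_rfl⟩) (i1 0 ⟨le_rfl, hT.le⟩)]
  have e1 : ∫ x in (0:ℝ)..1, (F T x - F 0 x) = ∫ x in (0:ℝ)..1, ∫ t in (0:ℝ)..T, D t x := by
    refine intervalIntegral.integral_congr fun x hx => ?_
    rw [uIcc_of_le h01] at hx
    refine (aux_ftc 0 T hT.le (fun s => F s x) (fun s => D s x) (fun t ht => hFt t ht x hx) ?_).symm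
    exact hD.comp (f := fun t : ℝ => (t, x)) (by fun_prop) (fun t ht => ⟨ht, hx⟩)
  have e2 : ∫ t in (0:ℝ)..T, ∫ x in (0:ℝ)..1, D t x = 0 := by
    rw [intervalIntegral.integral_congr (g := fun _ => (0:ℝ)) fun t ht => ?_]
    · simp
    rw [uIcc_of_le hT.le] at ht
    have := aux_ftc 0 1 h01 (fun y => G t y) (fun y => D t y) (fun x hx => hGx t ht x hx)
      (hD.comp (f := fun x : ℝ => (t, x)) (by fun_prop) (fun x hx => ⟨ht, hx⟩))
    simp only [this, hG t ht, sub_self]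
  rw [e1]
  refine Eq.trans ?_ e2
  simp only [intervalIntegral.integral_of_le h01, intervalIntegral.integral_of_le hT.le]
  symm
  apply MeasureTheory.integral_integral_swap
  rw [MeasureTheory.Measure.prod_restrict]
  have := hD.integrableOn_compact (μ := MeasureTheory.volume) (isCompact_Icc.prod isCompact_Icc)
  exact this.mono_set (prod_mono Ioc_subset_Icc_self Ioc_subset_Icc_self)

/-- Conservation of the duality pairing when the adjoint solution has zero observation
(Lemma 3.4 of the paper, for classical solutions). Here `n = k + m`,
`Σ(x) = diag(−λ₁(x),…,−λ_k(x), λ_{k+1}(x),…,λ_{k+m}(x))`, the direct solution `u` satisfies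
`u₋(t,0) = B u₊(t,0)` (with arbitrary boundary values `u₊(t,1)`), and the adjoint solution `v`
satisfies `v₋(t,1) = 0`, `v₊(t,1) = 0` and `Σ₊(0) v₊(t,0) = −Bᵀ Σ₋(0) v₋(t,0)`. -/
theorem stmt13 (k m : ℕ) (hk : 1 ≤ k) (hm : 1 ≤ m) (T : ℝ) (hT : 0 < T)
    (lam lam' : Fin (k + m) → ℝ → ℝ)
    (hpos : ∀ i, ∀ x ∈ Icc (0:ℝ) 1, 0 < lam i x)
    (hlam : ∀ i, ∀ x ∈ Icc (0:ℝ) 1, HasDerivWithinAt (lam i) (lam' i x) (Icc 0 1) x)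
    (hlamc : ∀ i, ContinuousOn (lam' i) (Icc 0 1))
    (B : Matrix (Fin k) (Fin m) ℝ)
    (C : ℝ → ℝ → Fin (k + m) → Fin (k + m) → ℝ)
    (hC : ContinuousOn (fun p : ℝ × ℝ => C p.1 p.2) (Icc 0 T ×ˢ Icc 0 1))
    (u ut ux v vt vx : ℝ → ℝ → Fin (k + m) → ℝ)
    (hu : ContinuousOn (fun p : ℝ × ℝ => u p.1 p.2) (Icc 0 T ×ˢ Icc 0 1))
    (hutc : ContinuousOn (fun p : ℝ × ℝ => ut p.1 p.2) (Icc 0 T ×ˢ Icc 0 1))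
    (huxc : ContinuousOn (fun p : ℝ × ℝ => ux p.1 p.2) (Icc 0 T ×ˢ Icc 0 1))
    (hv : ContinuousOn (fun p : ℝ × ℝ => v p.1 p.2) (Icc 0 T ×ˢ Icc 0 1))
    (hvtc : ContinuousOn (fun p : ℝ × ℝ => vt p.1 p.2) (Icc 0 T ×ˢ Icc 0 1))
    (hvxc : ContinuousOn (fun p : ℝ × ℝ => vx p.1 p.2) (Icc 0 T ×ˢ Icc 0 1))
    (hut : ∀ t ∈ Icc (0:ℝ) T, ∀ x ∈ Icc (0:ℝ) 1, ∀ i,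
      HasDerivWithinAt (fun s => u s x i) (ut t x i) (Icc 0 T) t)
    (hux : ∀ t ∈ Icc (0:ℝ) T, ∀ x ∈ Icc (0:ℝ) 1, ∀ i,
      HasDerivWithinAt (fun y => u t y i) (ux t x i) (Icc 0 1) x)
    (hvt : ∀ t ∈ Icc (0:ℝ) T, ∀ x ∈ Icc (0:ℝ) 1, ∀ i,
      HasDerivWithinAt (fun s => v s x i) (vt t x i) (Icc 0 T) t)
    (hvx : ∀ t ∈ Icc (0:ℝ) T, ∀ x ∈ Icc (0:ℝ) 1, ∀ i,
      HasDerivWithinAt (fun y => v t y i) (vx t x i) (Icc 0 1) x)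
    -- direct system: ∂_t u = Σ(x) ∂_x u + C(t,x) u
    (hupde : ∀ t ∈ Icc (0:ℝ) T, ∀ x ∈ Icc (0:ℝ) 1, ∀ i : Fin (k + m),
      ut t x i = (if (i : ℕ) < k then -lam i x else lam i x) * ux t x i +
        ∑ j, C t x i j * u t x j)
    -- u₋(t,0) = B u₊(t,0)
    (hu0 : ∀ t ∈ Icc (0:ℝ) T, ∀ j : Fin k,
      u t 0 (Fin.castAdd m j) = ∑ i : Fin m, B j i * u t 0 (Fin.natAdd k i))
    -- adjoint system: ∂_t v = Σ(x) ∂_x v + (Σ′(x) − C(t,x)ᵀ) v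
    (hvpde : ∀ t ∈ Icc (0:ℝ) T, ∀ x ∈ Icc (0:ℝ) 1, ∀ i : Fin (k + m),
      vt t x i = (if (i : ℕ) < k then -lam i x else lam i x) * vx t x i +
        (if (i : ℕ) < k then -lam' i x else lam' i x) * v t x i -
        ∑ j, C t x j i * v t x j)
    -- v₋(t,1) = 0
    (hv1 : ∀ t ∈ Icc (0:ℝ) T, ∀ j : Fin k, v t 1 (Fin.castAdd m j) = 0)
    -- v₊(t,1) = 0
    (hv1' : ∀ t ∈ Icc (0:ℝ) T, ∀ i : Fin m, v t 1 (Fin.natAdd k i) = 0)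
    -- Σ₊(0) v₊(t,0) = −Bᵀ Σ₋(0) v₋(t,0)
    (hv0 : ∀ t ∈ Icc (0:ℝ) T, ∀ i : Fin m,
      lam (Fin.natAdd k i) 0 * v t 0 (Fin.natAdd k i) =
        -∑ j : Fin k, B j i * (-lam (Fin.castAdd m j) 0 * v t 0 (Fin.castAdd m j))) :
    (∫ x in (0:ℝ)..1, ∑ i, u T x i * v T x i) =
      ∫ x in (0:ℝ)..1, ∑ i, u 0 x i * v 0 x i := by
  have cu := fun i => (continuousOn_pi.1 hu i)
  have cv := fun i => (continuousOn_pi.1 hv i)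
  have cut := fun i => (continuousOn_pi.1 hutc i)
  have cvt := fun i => (continuousOn_pi.1 hvtc i)
  refine aux_swap T hT (fun t x => ∑ i, u t x i * v t x i)
    (fun t x => ∑ i, (ut t x i * v t x i + u t x i * vt t x i))
    (fun t x => ∑ i : Fin (k + m), (if (i : ℕ) < k then (-1:ℝ) else 1) *
      (lam i x * (u t x i * v t x i))) ?_ ?_ ?_ ?_ ?_
  · intro t ht x hx
    refine HasDerivWithinAt.continuousWithinAt
      (f' := ∑ i, (ux t x i * v t x i + u t x i * vx t x i)) ?_
    exact HasDerivWithinAt.fun_sum fun i _ => (hux t ht x hx i).mul (hvx t ht x hx i)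
  · exact continuousOn_finsetSum _ fun i _ =>
      ((cut i).mul (cv i)).add ((cu i).mul (cvt i))
  · intro t ht x hx
    exact HasDerivWithinAt.fun_sum fun i _ => (hut t ht x hx i).mul (hvt t ht x hx i)
  · intro t ht x hx
    have h := HasDerivWithinAt.fun_sum (u := Finset.univ) fun (i : Fin (k + m)) _ =>
      ((hlam i x hx).mul ((hux t ht x hx i).mul (hvx t ht x hx i))).const_mul
        (if (i : ℕ) < k then (-1:ℝ) else 1)
    refine h.congr_deriv ?_
    have hsw : ∑ i, (∑ j, C t x i j * u t x j) * v t x i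
        = ∑ i, u t x i * ∑ j, C t x j i * v t x j := by
      simp only [Finset.sum_mul, Finset.mul_sum]
      rw [Finset.sum_comm]
      exact Finset.sum_congr rfl fun i _ => Finset.sum_congr rfl fun j _ => by ring
    rw [← sub_eq_zero] at hsw ⊢
    rw [← neg_eq_zero] at hsw
    rw [← hsw, ← Finset.sum_sub_distrib, ← Finset.sum_sub_distrib, ← Finset.sum_neg_distrib]
    refine Finset.sum_congr rfl fun i _ => ?_
    rw [hupde t ht x hx i, hvpde t ht x hx i]
    simp only [Pi.mul_apply]
    split_ifs <;> ring
  · intro t ht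
    simp only [Fin.sum_univ_add, hv1 t ht, hv1' t ht, Fin.val_castAdd, Fin.is_lt, if_true,
      Fin.val_natAdd, mul_zero, Finset.sum_const_zero, add_zero, not_lt.2 (Nat.le_add_right k _), if_false]
    have h2 : ∀ i : Fin m, (1:ℝ) * (lam (Fin.natAdd k i) 0 *
        (u t 0 (Fin.natAdd k i) * v t 0 (Fin.natAdd k i))) = ∑ j : Fin k, u t 0 (Fin.natAdd k i) *
        (B j i * (lam (Fin.castAdd m j) 0 * v t 0 (Fin.castAdd m j))) := by
      intro i
      rw [← Finset.mul_sum]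
      have := hv0 t ht i
      simp only [neg_mul, mul_neg, Finset.sum_neg_distrib, neg_neg] at this
      rw [← this]; ring
    simp only [h2, hu0 t ht]
    rw [Finset.sum_comm (s := (Finset.univ : Finset (Fin m))), ← Finset.sum_add_distrib]
    symm
    refine Finset.sum_eq_zero fun j _ => ?_
    simp only [Finset.sum_mul, Finset.mul_sum]
    rw [← Finset.sum_add_distrib]
    exact Finset.sum_eq_zero fun i _ => by ring
end
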